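/- arXiv:2411.19365 — 5 statements merged into one kernel-verified Lean document; each statement's English description precedes it below -/
import Mathlib

section
/- Consensus among 2 processes can be solved wait-free using two single-writer registers and one atomic bag initialized with a single element: the algorithm in which a process proposing x writes x to its own single-writer register, then performs Take() on the bag, decides x if the Take returned an element, and otherwise decides the value read from the other process's register, satisfies agreement (no two processes decide different values), validity (every decided value was proposed), and wait-free termination (each process decides within finitely many of its own steps, regardless of the interleaving). -/
/-!
**Statement 4.** Consensus among 2 processes can be solved wait-free using two
single-writer registers and one atomic bag initialized with a single element.

The two processes are indexed by `Bool`.  The algorithm for process `p`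
proposing `x p` is:

1. write `x p` to its own single-writer register `regs p`;
2. perform `Take()` on the bag; if the `Take` returned an element, decide
   `x p`;
3. otherwise read the other process's register and decide the value read.

Since the bag initially holds a single element and no element is ever
inserted, it always holds at most one element and is modelled as an
`Option ℕ`; every bag operation takes effect atomically in a single step.
The scheduler is an arbitrary infinite sequence `σ : ℕ → Bool` of process
indices; a process that has already decided takes no further (meaningful)
steps.
-/

namespace ConsBag

structure Cfg where
  /-- the two single-writer registers (initially unwritten) -/
  regs : Bool → Option ℕ
  /-- the atomic bag, holding at most one element -/
  bag : Option ℕ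
  /-- program counters of the two processes -/
  pc : Bool → ℕ
  /-- decisions of the two processes -/
  dec : Bool → Option ℕ

def init (v₀ : ℕ) : Cfg :=
  { regs := fun _ => none
    bag := some v₀
    pc := fun _ => 0
    dec := fun _ => none }

/-- One step of process `p` with input values `x`. -/
def step (x : Bool → ℕ) (C : Cfg) (p : Bool) : Cfg :=
  match C.pc p with
  | 0 => -- write own register
      { C with regs := Function.update C.regs p (some (x p))
               pc := Function.update C.pc p 1 }
  | 1 => -- Take() on the bag
      match C.bag with
      | some _ =>
          { C with bag := none
                   pc := Function.update C.pc p 3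
                   dec := Function.update C.dec p (some (x p)) }
      | none => { C with pc := Function.update C.pc p 2 }
  | 2 => -- read the other register and decide the value read
      { C with pc := Function.update C.pc p 3
               dec := Function.update C.dec p (some ((C.regs (!p)).getD 0)) }
  | _ => C

/-- The configuration after `t` steps under schedule `σ`, with inputs `x` and
initial bag element `v₀`. -/
def runSched (x : Bool → ℕ) (v₀ : ℕ) (σ : ℕ → Bool) : ℕ → Cfg
  | 0 => init v₀
  | t + 1 => step x (runSched x v₀ σ t) (σ t)

end ConsBag

namespace ConsBag

/-- The inductive invariant: registers of started processes hold their inputs, a process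
has decided exactly when its counter is 3, and once the bag is empty there is a winner
`w` which decided its own input, the only value that can be decided. -/
def Inv (x : Bool → ℕ) (C : Cfg) : Prop :=
  (∀ p, C.pc p ≤ 3) ∧
  (∀ p, 1 ≤ C.pc p → C.regs p = some (x p)) ∧
  (∀ p, (C.dec p).isSome ↔ C.pc p = 3) ∧
  ((C.bag.isSome ∧ ∀ p, C.pc p ≤ 1) ∨
    (C.bag = none ∧ ∃ w, C.pc w = 3 ∧ ∀ p v, C.dec p = some v → v = x w))

theorem inv_step (x : Bool → ℕ) (C : Cfg) (p : Bool) (h : Inv x C) :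
    Inv x (step x C p) := by
  obtain ⟨h1, h2, h3, h4⟩ := h
  have h1p := h1 p
  unfold step
  split
  · refine ⟨?_, ?_, ?_, ?_⟩
    · grind [Function.update_apply]
    · grind [Function.update_apply]
    · grind [Function.update_apply]
    · rcases h4 with h4 | ⟨hb, w, hw, hd⟩
      · left; grind [Function.update_apply]
      · refine Or.inr ⟨hb, w, ?_, hd⟩
        grind [Function.update_apply]
  · split
    · refine ⟨?_, ?_, ?_, Or.inr ⟨rfl, p, ?_, ?_⟩⟩ <;> grind [Function.update_apply]
    · rcases h4 with h4 | ⟨hb, w, hw, hd⟩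
      · grind
      · refine ⟨?_, ?_, ?_, Or.inr ⟨hb, w, ?_, hd⟩⟩ <;> grind [Function.update_apply]
  · rcases h4 with h4 | ⟨hb, w, hw, hd⟩
    · grind
    · have hwp : w = !p := by
        cases w <;> cases p <;> simp_all
      have hr : C.regs (!p) = some (x w) := by
        rw [hwp]; apply h2; rw [← hwp]; omega
      refine ⟨?_, ?_, ?_, Or.inr ⟨hb, w, ?_, ?_⟩⟩ <;> grind [Function.update_apply]
  · exact ⟨h1, h2, h3, h4⟩

theorem inv_run (x : Bool → ℕ) (v₀ : ℕ) (σ : ℕ → Bool) (t : ℕ) :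
    Inv x (runSched x v₀ σ t) := by
  induction t with
  | zero => simp [runSched, init, Inv]
  | succ t ih => exact inv_step x _ _ ih

theorem dec_step (x : Bool → ℕ) (C : Cfg) (p q : Bool) (v : ℕ) (h : Inv x C)
    (hd : C.dec q = some v) : (step x C p).dec q = some v := by
  have hq : C.pc q = 3 := (h.2.2.1 q).1 (by simp [hd])
  unfold step
  split
  · exact hd
  · split <;> grind [Function.update_apply]
  · grind [Function.update_apply]
  · exact hd

theorem dec_mono (x : Bool → ℕ) (v₀ : ℕ) (σ : ℕ → Bool) (q : Bool) (v t t' : ℕ)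
    (htt : t ≤ t') (hd : (runSched x v₀ σ t).dec q = some v) :
    (runSched x v₀ σ t').dec q = some v := by
  induction t', htt using Nat.le_induction with
  | base => exact hd
  | succ n _ ih => exact dec_step x _ _ _ _ (inv_run x v₀ σ n) ih

theorem pc_step (x : Bool → ℕ) (C : Cfg) (q p : Bool) (h : C.pc p ≤ 3) :
    C.pc p + (if q = p then 1 else 0) ≤ (step x C q).pc p ∨
      (C.pc p = 3 ∧ (step x C q).pc p = 3) := by
  unfold step
  by_cases hqp : q = p
  · subst hqp
    rw [if_pos rfl]
    split
    · left; simp_all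
    · left; split <;> simp_all
    · left; simp_all
    · right
      have : C.pc q = 3 := by grind
      exact ⟨this, this⟩
  · have hpq : p ≠ q := fun e => hqp e.symm
    rw [if_neg hqp]
    left
    split
    · simp [hpq]
    · split <;> simp [hpq]
    · simp [hpq]
    · simp

theorem count_run (x : Bool → ℕ) (v₀ : ℕ) (σ : ℕ → Bool) (p : Bool) (t : ℕ) :
    (List.range t).countP (fun s => decide (σ s = p)) ≤ (runSched x v₀ σ t).pc p ∨
      (runSched x v₀ σ t).pc p = 3 := by
  induction t with
  | zero => simp
  | succ t ih =>
    have hi := (inv_run x v₀ σ t).1 p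
    have hi' : (step x (runSched x v₀ σ t) (σ t)).pc p ≤ 3 := (inv_run x v₀ σ (t + 1)).1 p
    have hs := pc_step x (runSched x v₀ σ t) (σ t) p hi
    rw [List.range_succ, List.countP_append, List.countP_singleton]
    simp only [runSched, decide_eq_true_eq]
    split_ifs at hs ⊢ <;> omega

end ConsBag

/--
The above algorithm solves consensus among 2 processes,
wait-free, using two single-writer registers and one atomic bag initialized
with a single element: for all inputs `x`, all initial bag elements `v₀`, and
every schedule `σ`,

* (agreement) no two processes decide different values;
* (validity) every decided value was proposed; and
* (wait-free termination) each process decides within finitely many of its own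
  steps — indeed within 3 of its own steps — regardless of the interleaving.
-/
theorem consensus_from_bag (x : Bool → ℕ) (v₀ : ℕ) (σ : ℕ → Bool) :
    -- agreement
    (∀ t₁ t₂ p q vp vq,
        (ConsBag.runSched x v₀ σ t₁).dec p = some vp →
        (ConsBag.runSched x v₀ σ t₂).dec q = some vq → vp = vq) ∧
    -- validity
    (∀ t p v, (ConsBag.runSched x v₀ σ t).dec p = some v →
        v = x true ∨ v = x false) ∧
    (∀ t p, 3 ≤ (List.range t).countP (fun s => decide (σ s = p)) →
        ((ConsBag.runSched x v₀ σ t).dec p).isSome) := by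
  refine ⟨?_, ?_, ?_⟩
  · intro t₁ t₂ p q vp vq hp hq
    have hp' := ConsBag.dec_mono x v₀ σ p vp t₁ (max t₁ t₂) (le_max_left _ _) hp
    have hq' := ConsBag.dec_mono x v₀ σ q vq t₂ (max t₁ t₂) (le_max_right _ _) hq
    obtain ⟨_, _, h3, h4⟩ := ConsBag.inv_run x v₀ σ (max t₁ t₂)
    rcases h4 with ⟨_, h⟩ | ⟨_, w, _, h⟩
    · have := (h3 p).1 (by simp [hp'])
      have := h p
      omega
    · rw [h p vp hp', h q vq hq']
  · intro t p v hp
    obtain ⟨_, _, h3, h4⟩ := ConsBag.inv_run x v₀ σ t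
    rcases h4 with ⟨_, h⟩ | ⟨_, w, _, h⟩
    · have := (h3 p).1 (by simp [hp])
      have := h p
      omega
    · have := h p v hp
      cases w
      · exact Or.inr this
      · exact Or.inl this
  · intro t p hc
    have hi := ConsBag.inv_run x v₀ σ t
    have h1 := hi.1 p
    have h2 := ConsBag.count_run x v₀ σ p t
    exact (hi.2.2.1 p).2 (by omega)
end

section
/- In every execution of the Figure 3 algorithm: before the producer first performs its write of an element to Items[m] (the final write step of a successful Insert), and whenever the producer is strictly between its write of ⊥ to Items[m] and its next write of an element to Items[m], all entries of Items are ⊥; in every other configuration, Items[Allocated] ≠ ⊥ and all other entries of Items are ⊥. -/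
/-!
A formal model of the algorithm of Figure 3 (a wait-free, linearizable
1-bounded bag with one producer and `n` consumers).

Locations `1 .. n+1` are modelled as `Fin (n+1)` with index `0` playing the
role of location `1` (so `TS[1] = 1` initially becomes `ts 0 = true`).
Registers holding elements or `⊥` are modelled as `Option ℕ` (with `none` = ⊥),
test&set objects as `Bool` (`true` = 1).

An execution is a list of actions (`Act`), each of which performs exactly one
shared-memory access (an invocation of an operation is merged with the first
shared access of that operation, and nondeterministic choices and results of
accesses are recorded in the action).  `step` is the (partial, deterministic)
transition function; a list `tr` is a (finite) execution iff
`run n tr (init n) = some C` for some configuration `C`.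
-/

namespace Fig3

abbrev Loc (n : ℕ) := Fin (n + 1)

/-- Local state (program counter and local variables) of the single producer,
apart from the persistent local variables `used` and `m` that are kept in the
configuration. -/
inductive PSt (n : ℕ) where
  | idle : PSt n
  | clear (x : ℕ) : PSt n
  | collect (x : ℕ) (i : ℕ) (hz : Finset (Loc n)) : PSt n
  | allocSt (x : ℕ) (hz : Finset (Loc n)) : PSt n
  | resets (x : ℕ) (hz : Finset (Loc n)) (todo : Finset (Loc n)) : PSt n
  deriving DecidableEq

/-- Local state of a consumer. -/
inductive CSt (n : ℕ) where
  | idle : CSt n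
  | haz (a : Loc n) : CSt n
  | read (a : Loc n) : CSt n
  | tas (a : Loc n) (x : ℕ) : CSt n
  | clear (res : Option ℕ) : CSt n
  deriving DecidableEq

structure Cfg (n : ℕ) where
  items : Loc n → Option ℕ
  ts : Loc n → Bool
  alloc : Loc n
  haz : Fin n → Option (Loc n)
  pst : PSt n
  used : Finset (Loc n)
  m : Loc n
  cst : Fin n → CSt n

inductive Act (n : ℕ) where
  /-- the producer begins `Insert(x)` by reading `TS[m]`, obtaining `v`;
      if `v = false` (i.e. 0) the operation immediately returns FULL -/
  | insCheck (x : ℕ) (v : Bool) : Act n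
  /-- the producer writes ⊥ to `Items[m]` and adds `m` to `used` -/
  | insClear : Act n
  /-- the producer reads the next entry of `Hazards` -/
  | insCollect : Act n
  /-- the producer chooses a fresh non-hazardous location `m'`
      and writes it to `Allocated` -/
  | insAlloc (m' : Loc n) : Act n
  /-- the producer resets `TS[k]` -/
  | insReset (k : Loc n) : Act n
  /-- the producer writes its element to `Items[m]` and returns OK -/
  | insWrite : Act n
  /-- consumer `i` begins `Take()` by reading `Allocated`, obtaining `a` -/
  | takeBegin (i : Fin n) (a : Loc n) : Act n
  /-- consumer `i` writes its announced location to `Hazards[i]` -/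
  | takeHaz (i : Fin n) : Act n
  /-- consumer `i` reads `Items[a]`, obtaining `x` -/
  | takeRead (i : Fin n) (x : Option ℕ) : Act n
  /-- consumer `i` performs `t&s()` on `TS[a]`; `won = true` iff it was successful -/
  | takeTas (i : Fin n) (won : Bool) : Act n
  /-- consumer `i` writes ⊥ to `Hazards[i]` and returns `res`
      (`none` meaning EMPTY) -/
  | takeEnd (i : Fin n) (res : Option ℕ) : Act n
  deriving DecidableEq

/-- One step of the algorithm: `step n C e = some C'` iff action `e` is enabled
in configuration `C` (including that all recorded read/`t&s` results match the
shared state) and leads to configuration `C'`. -/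
def step (n : ℕ) (C : Cfg n) : Act n → Option (Cfg n)
  | .insCheck x v =>
      match C.pst with
      | .idle =>
          if v = C.ts C.m then
            some (if v then { C with pst := .clear x } else C)
          else none
      | _ => none
  | .insClear =>
      match C.pst with
      | .clear x =>
          some { C with
                   items := Function.update C.items C.m none
                   used := insert C.m C.used
                   pst := if n = 0 then .allocSt x ∅ else .collect x 0 ∅ }
      | _ => none
  | .insCollect =>
      match C.pst with
      | .collect x i hz =>
          if h : i < n then
            let hz' := match C.haz ⟨i, h⟩ with
                       | some a => insert a hz
                       | none => hz
            some { C with pst := if i + 1 = n then .allocSt x hz' else .collect x (i + 1) hz' }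
          else none
      | _ => none
  | .insAlloc m' =>
      match C.pst with
      | .allocSt x hz =>
          if m' ∈ hz then none
          else some { C with
                        alloc := m'
                        m := m'
                        pst := .resets x hz (C.used \ hz) }
      | _ => none
  | .insReset k =>
      match C.pst with
      | .resets x hz todo =>
          if k ∈ todo then
            some { C with
                     ts := Function.update C.ts k false
                     pst := .resets x hz (todo.erase k) }
          else none
      | _ => none
  | .insWrite =>
      match C.pst with
      | .resets x hz todo =>
          if todo = ∅ then
            some { C with
                     items := Function.update C.items C.m (some x)
                     used := C.used ∩ hz
                     pst := .idle }
          else none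
      | _ => none
  | .takeBegin i a =>
      match C.cst i with
      | .idle =>
          if a = C.alloc then some { C with cst := Function.update C.cst i (.haz a) }
          else none
      | _ => none
  | .takeHaz i =>
      match C.cst i with
      | .haz a =>
          some { C with
                   haz := Function.update C.haz i (some a)
                   cst := Function.update C.cst i (.read a) }
      | _ => none
  | .takeRead i xo =>
      match C.cst i with
      | .read a =>
          if xo = C.items a then
            some { C with
                     cst := Function.update C.cst i
                       (match xo with
                        | some v => .tas a v
                        | none => .clear none) }
          else none
      | _ => none
  | .takeTas i won =>
      match C.cst i with
      | .tas a x =>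
          if won = !(C.ts a) then
            some { C with
                     ts := Function.update C.ts a true
                     cst := Function.update C.cst i (.clear (if won then some x else none)) }
          else none
      | _ => none
  | .takeEnd i res =>
      match C.cst i with
      | .clear r =>
          if res = r then
            some { C with
                     haz := Function.update C.haz i none
                     cst := Function.update C.cst i .idle }
          else none
      | _ => none

/-- The initial configuration: all items ⊥, `TS[1] = 1` and all other test&set
objects 0, `Allocated = m = 1`, `used = ∅`, everyone idle. -/
def init (n : ℕ) : Cfg n where
  items := fun _ => none
  ts := fun k => decide (k = 0)
  alloc := 0
  haz := fun _ => none
  pst := .idle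
  used := ∅
  m := 0
  cst := fun _ => .idle

/-- Run a list of actions from a configuration. -/
def run (n : ℕ) : List (Act n) → Cfg n → Option (Cfg n)
  | [], C => some C
  | e :: tr, C => (step n C e).bind (run n tr)

/-- The configuration reached after the first `t` actions of `tr`. -/
def cfgAt (n : ℕ) (tr : List (Act n)) (t : ℕ) : Option (Cfg n) :=
  run n (tr.take t) (init n)

end Fig3

namespace Fig3

/-- The producer is strictly between its write of ⊥ to `Items[m]`
(action `insClear`) and its next write of an element to `Items[m]`
(action `insWrite`). -/
def midInsert {n : ℕ} : PSt n → Prop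
  | .collect _ _ _ => True
  | .allocSt _ _ => True
  | .resets _ _ _ => True
  | _ => False

end Fig3

namespace Fig3

/-- The inductive invariant; `W` says that an `insWrite` has already happened. -/
def ItemsInv {n : ℕ} (W : Prop) (C : Cfg n) : Prop :=
  C.alloc = C.m ∧
  ((¬ W ∨ midInsert C.pst) → ∀ k, C.items k = none) ∧
  ((W ∧ ¬ midInsert C.pst) →
    C.items C.alloc ≠ none ∧ ∀ k, k ≠ C.alloc → C.items k = none)

/-- A step that keeps items, alloc, m and the `midInsert` status keeps the invariant. -/
theorem ItemsInv.congr {n : ℕ} {W W' : Prop} {C C' : Cfg n} (h : ItemsInv W C)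
    (hW : W' ↔ W) (hi : C'.items = C.items) (ha : C'.alloc = C.alloc) (hm : C'.m = C.m)
    (hp : midInsert C'.pst ↔ midInsert C.pst) : ItemsInv W' C' := by
  unfold ItemsInv at *
  rw [hi, ha, hm, hp, hW]
  exact h

theorem itemsInv_step {n : ℕ} (W : Prop) (C C' : Cfg n) (e : Act n)
    (h : ItemsInv W C) (hs : step n C e = some C') :
    ItemsInv (W ∨ e = Act.insWrite) C' := by
  cases e with
  | insCheck x v =>
    simp only [step] at hs
    split at hs <;> try contradiction
    rename_i hp
    split at hs <;> try contradiction
    cases hs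
    cases v <;> exact h.congr (by simp) rfl rfl rfl (by simp [hp, midInsert])
  | insClear =>
    simp only [step] at hs
    split at hs <;> try contradiction
    rename_i x hp
    cases hs
    obtain ⟨h1, h2, h3⟩ := h
    simp only [hp, midInsert, h1] at h2 h3
    have key : ∀ k, Function.update C.items C.m none k = none := by
      intro k
      by_cases hk : k = C.m
      · simp [hk]
      · rw [Function.update_of_ne hk]
        by_cases hW : W
        · exact (h3 ⟨hW, id⟩).2 k hk
        · exact h2 (Or.inl hW) k
    refine ⟨h1, fun _ => key, fun hh => absurd ?_ hh.2⟩
    by_cases hn : n = 0 <;> simp [hn, midInsert]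
  | insCollect =>
    simp only [step] at hs
    split at hs <;> try contradiction
    rename_i x i hz hp
    split at hs <;> try contradiction
    cases hs
    refine h.congr (by simp) rfl rfl rfl ?_
    rw [hp]
    dsimp only
    split <;> simp [midInsert]
  | insAlloc m' =>
    simp only [step] at hs
    split at hs <;> try contradiction
    rename_i x hz hp
    split at hs <;> try contradiction
    cases hs
    exact ⟨rfl, fun _ => h.2.1 (Or.inr (by simp [hp, midInsert])),
      fun hh => absurd (by simp [midInsert]) hh.2⟩
  | insReset k =>
    simp only [step] at hs
    split at hs <;> try contradiction
    rename_i x hz todo hp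
    split at hs <;> try contradiction
    cases hs
    exact h.congr (by simp) rfl rfl rfl (by simp [hp, midInsert])
  | insWrite =>
    simp only [step] at hs
    split at hs <;> try contradiction
    rename_i x hz todo hp
    split at hs <;> try contradiction
    cases hs
    have h2 := h.2.1 (Or.inr (by simp [hp, midInsert]))
    refine ⟨h.1, ?_, fun _ => ⟨?_, ?_⟩⟩
    · rintro (hh | hh)
      · exact absurd (Or.inr rfl) hh
      · exact hh.elim
    · simp [h.1]
    · intro k hk
      have hk' : k ≠ C.m := fun hkm => hk (hkm.trans h.1.symm)
      simp [Function.update_of_ne hk', h2 k]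
  | takeHaz i =>
    simp only [step] at hs
    split at hs <;> try contradiction
    cases hs
    exact h.congr (by simp) rfl rfl rfl Iff.rfl
  | takeBegin i a | takeRead i xo | takeTas i won | takeEnd i res =>
    simp only [step] at hs
    split at hs <;> try contradiction
    split at hs <;> try contradiction
    cases hs
    exact h.congr (by simp) rfl rfl rfl Iff.rfl

theorem itemsInv_run {n : ℕ} (tr : List (Act n)) : ∀ (W : Prop) (C C' : Cfg n),
    ItemsInv W C → run n tr C = some C' → ItemsInv (W ∨ Act.insWrite ∈ tr) C' := by
  induction tr with
  | nil =>
    intro W C C' h hr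
    cases hr
    exact h.congr (by simp) rfl rfl rfl Iff.rfl
  | cons e tr ih =>
    intro W C C' h hr
    obtain ⟨D, hD, hr'⟩ := Option.bind_eq_some_iff.mp hr
    exact (ih _ D C' (itemsInv_step W C D e h hD) hr').congr
      (by rw [List.mem_cons, or_assoc, eq_comm]) rfl rfl rfl Iff.rfl

end Fig3

/--
In every execution of the Figure 3 algorithm: before the
producer first performs its write of an element to `Items[m]` (the final write
step `insWrite` of a successful `Insert`), and whenever the producer is
strictly between its write of ⊥ to `Items[m]` and its next write of an element
to `Items[m]`, all entries of `Items` are ⊥; in every other configuration,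
`Items[Allocated] ≠ ⊥` and all other entries of `Items` are ⊥.
-/
theorem fig3_items_invariant (n : ℕ) (tr : List (Fig3.Act n)) (C : Fig3.Cfg n)
    (hrun : Fig3.run n tr (Fig3.init n) = some C) :
    ((Fig3.Act.insWrite ∉ tr ∨ Fig3.midInsert C.pst) →
        ∀ k, C.items k = none) ∧
    ((Fig3.Act.insWrite ∈ tr ∧ ¬ Fig3.midInsert C.pst) →
        C.items C.alloc ≠ none ∧ ∀ k, k ≠ C.alloc → C.items k = none) := by
  have h0 : Fig3.ItemsInv False (Fig3.init n) :=
    ⟨rfl, fun _ _ => rfl, fun hh => hh.1.elim⟩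
  have h := Fig3.itemsInv_run tr False _ C h0 hrun
  simp only [false_or] at h
  exact h.2
end

section
/- In every configuration of every execution of the Figure 3 algorithm, for every index k, if k is in the producer's local set used, then Items[k] = ⊥. -/
namespace Fig3

/-- The invariant: items at used locations are `⊥`, and after the allocation
step the freshly allocated location is not hazardous. -/
def Inv (n : ℕ) (C : Cfg n) : Prop :=
  (∀ k ∈ C.used, C.items k = none) ∧
    ∀ x hz todo, C.pst = .resets x hz todo → C.m ∉ hz

theorem inv_step (n : ℕ) (C C' : Cfg n) (e : Act n) (hC : Inv n C)
    (h : step n C e = some C') : Inv n C' := by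
  obtain ⟨h1, h2⟩ := hC
  cases e with
  | insWrite =>
    simp only [step] at h
    split at h
    · rename_i x hz todo hp
      split_ifs at h
      have hm := h2 _ _ _ hp
      cases h
      refine ⟨?_, by simp⟩
      intro k hk
      obtain ⟨hk1, hk2⟩ := Finset.mem_inter.mp hk
      have hne : k ≠ C.m := fun hh => hm (hh ▸ hk2)
      simpa [Function.update_of_ne hne] using h1 k hk1
    · cases h
  | insClear =>
    simp only [step] at h
    split at h
    · cases h
      refine ⟨?_, ?_⟩
      · intro k hk
        by_cases hne : k = C.m
        · simp [hne]
        · have hk1 : k ∈ C.used := by simpa [hne] using hk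
          simpa [Function.update_of_ne hne] using h1 k hk1
      · intro x hz todo hp
        simp only at hp
        split_ifs at hp
    · cases h
  | insReset k =>
    simp only [step] at h
    split at h
    · rename_i x hz todo hp
      split_ifs at h
      have hm := h2 _ _ _ hp
      cases h
      refine ⟨h1, ?_⟩
      intro x' hz' todo' hp'
      cases hp'
      exact hm
    · cases h
  | insAlloc m' =>
    simp only [step] at h
    split at h
    · split_ifs at h with hm
      cases h
      refine ⟨h1, ?_⟩
      intro x' hz' todo' hp'
      cases hp'
      exact hm
    · cases h
  | insCollect =>
    simp only [step] at h
    split at h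
    · split_ifs at h <;> cases h <;> exact ⟨h1, by simp⟩
    · cases h
  | insCheck x v =>
    simp only [step] at h
    split at h
    · split_ifs at h <;> cases h
      · exact ⟨h1, by simp⟩
      · exact ⟨h1, h2⟩
    · cases h
  | takeHaz i =>
    simp only [step] at h
    split at h
    · cases h
      exact ⟨h1, h2⟩
    · cases h
  | _ =>
    simp only [step] at h
    split at h
    · split_ifs at h <;> cases h <;> exact ⟨h1, h2⟩
    · cases h

theorem inv_run (n : ℕ) (tr : List (Act n)) :
    ∀ C C' : Cfg n, Inv n C → run n tr C = some C' → Inv n C' := by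
  induction tr with
  | nil =>
    intro C C' hC h
    cases h
    exact hC
  | cons e tr ih =>
    intro C C' hC h
    obtain ⟨D, hD, hr⟩ := Option.bind_eq_some_iff.mp h
    exact ih D C' (inv_step n C D e hC hD) hr

end Fig3

/--
In every configuration of every execution of the Figure 3
algorithm, for every index `k`, if `k` is in the producer's local set `used`,
then `Items[k] = ⊥`.
-/
theorem fig3_mem_used_implies_item_bot (n : ℕ) (tr : List (Fig3.Act n)) (C : Fig3.Cfg n)
    (hrun : Fig3.run n tr (Fig3.init n) = some C) :
    ∀ k ∈ C.used, C.items k = none := by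
  exact (Fig3.inv_run n tr _ C ⟨by simp [Fig3.init], by simp [Fig3.init]⟩ hrun).1
end

section
/- In every execution of the Figure 3 algorithm, let tk be a Take operation that returns EMPTY and let e be the step at which tk reads Allocated, obtaining value a. If Items[a] ≠ ⊥ and TS[a] = 0 at step e, then some Take operation performs a successful t&s() of TS[a] after e and before tk completes. -/
namespace Fig3

theorem run_append (n : ℕ) (l₁ l₂ : List (Act n)) (C : Cfg n) :
    run n (l₁ ++ l₂) C = (run n l₁ C).bind (run n l₂) := by
  induction l₁ generalizing C with
  | nil => rfl
  | cons e l ih =>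
    simp only [List.cons_append, run, Option.bind_assoc]
    congr 1
    funext D
    exact ih D

theorem cfgAt_succ {n : ℕ} {tr : List (Act n)} {t : ℕ} {e : Act n} (h : tr[t]? = some e) :
    cfgAt n tr (t + 1) = (cfgAt n tr t).bind (fun C => step n C e) := by
  unfold cfgAt
  rw [List.take_add_one, h, run_append]
  congr 1
  funext C
  simp [run]

theorem cfgAt_isSome_of_succ {n : ℕ} {tr : List (Act n)} {t : ℕ}
    (h : (cfgAt n tr (t + 1)).isSome) : (cfgAt n tr t).isSome := by
  unfold cfgAt at *
  rw [List.take_add_one, run_append] at h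
  cases h' : run n (tr.take t) (init n) with
  | none => simp [h'] at h
  | some C => rfl

theorem cfgAt_isSome_of_le {n : ℕ} {tr : List (Act n)} {s t : ℕ} (hst : s ≤ t)
    (h : (cfgAt n tr t).isSome) : (cfgAt n tr s).isSome := by
  induction t, hst using Nat.le_induction with
  | base => exact h
  | succ t _ ih => exact ih (cfgAt_isSome_of_succ h)

/-- Global invariant. -/
structure Inv_s13 {n : ℕ} (C : Cfg n) : Prop where
  allocm : C.alloc = C.m
  items : ∀ k, C.items k ≠ none → k = C.m ∧ (C.pst = .idle ∨ ∃ x, C.pst = .clear x)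
  clr : ∀ x, C.pst = .clear x → C.ts C.m = true

theorem Inv_s13.init (n : ℕ) : Inv_s13 (init n) :=
  ⟨rfl, by simp [Fig3.init], by simp [Fig3.init]⟩

theorem Inv_s13.step {n : ℕ} {C D : Cfg n} {e : Act n} (h : Inv_s13 C) (hs : step n C e = some D) :
    Inv_s13 D := by
  obtain ⟨h1, h2, h3⟩ := h
  rcases e with ⟨x, v⟩ | _ | _ | _ | _ | _ | _ | _ | _ | _ | _
  case insCheck =>
    simp only [Fig3.step] at hs
    split at hs <;> try contradiction
    split at hs <;> try contradiction
    cases v <;> cases hs <;> constructor <;> grind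
  all_goals simp only [Fig3.step] at hs
  all_goals split at hs
  all_goals try contradiction
  all_goals try split at hs
  all_goals try contradiction
  all_goals
    cases hs
    constructor <;> (try dsimp only) <;> grind [Function.update_apply]

theorem Inv_s13.run {n : ℕ} {l : List (Act n)} {C D : Cfg n} (h : Inv_s13 C)
    (hs : run n l C = some D) : Inv_s13 D := by
  induction l generalizing C with
  | nil => cases hs; exact h
  | cons e l ih =>
    simp only [Fig3.run, Option.bind_eq_some_iff] at hs
    obtain ⟨E, hE, hs⟩ := hs
    exact ih (h.step hE) hs

/-- What holds from the start of the `Take` until the first successful `t&s` of `TS[a]`. -/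
structure Pend {n : ℕ} (i : Fin n) (a : Loc n) (C : Cfg n) : Prop where
  idle : C.pst = .idle
  meq : C.m = a
  ts : C.ts a = false
  item : C.items a ≠ none
  cst : C.cst i = .haz a ∨ C.cst i = .read a ∨ ∃ x, C.cst i = .tas a x

theorem Pend.step {n : ℕ} {i : Fin n} {a : Loc n} {C D : Cfg n} {e : Act n} (h : Pend i a C)
    (hs : step n C e = some D)
    (hno : ¬ ∃ j y, e = .takeTas j true ∧ C.cst j = .tas a y) : Pend i a D := by
  obtain ⟨h1, h2, h3, h4, h5⟩ := h
  cases e <;> simp only [Fig3.step, h1] at hs <;> try contradiction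
  all_goals try split at hs
  all_goals try contradiction
  all_goals try split at hs
  all_goals try contradiction
  all_goals
    cases hs
    constructor <;> (try dsimp only) <;> grind [Function.update_apply]

end Fig3

/--
In every execution of the Figure 3 algorithm, let `tk` be a
`Take` operation (by consumer `i`) that returns EMPTY (it begins at position
`t₀` and completes at position `tEnd`, returning `none`), and let `e` be the
step at which `tk` reads `Allocated`, obtaining value `a` (this is exactly
position `t₀`).  If `Items[a] ≠ ⊥` and `TS[a] = 0` at step `e`, then some
`Take` operation (by some consumer `j`) performs a successful `t&s()` of
`TS[a]` after `e` and before `tk` completes.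
-/
theorem fig3_unsuccessful_take_witnesses_tas (n : ℕ) (tr : List (Fig3.Act n))
    (i : Fin n) (a : Fig3.Loc n) (t₀ tEnd : ℕ) (C₀ : Fig3.Cfg n)
    (hC₀ : Fig3.cfgAt n tr t₀ = some C₀)
    (hbegin : tr[t₀]? = some (Fig3.Act.takeBegin i a))
    (hlt : t₀ < tEnd)
    (hend : tr[tEnd]? = some (Fig3.Act.takeEnd i none))
    -- `tEnd` is the completion of the operation begun at `t₀`
    (hfirst : ∀ u r, t₀ < u → u < tEnd → tr[u]? ≠ some (Fig3.Act.takeEnd i r))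
    (hvalid : (Fig3.cfgAt n tr (tEnd + 1)).isSome)
    (hitem : C₀.items a ≠ none)
    (hts : C₀.ts a = false) :
    ∃ u j y Cu, t₀ < u ∧ u < tEnd ∧
      Fig3.cfgAt n tr u = some Cu ∧
      tr[u]? = some (Fig3.Act.takeTas j true) ∧
      Cu.cst j = Fig3.CSt.tas a y := by
  by_contra hcon
  have key : ∀ u, t₀ + 1 ≤ u → u ≤ tEnd → ∀ C, Fig3.cfgAt n tr u = some C → Fig3.Pend i a C := by
    intro u hu
    induction u, hu using Nat.le_induction with
    | base =>
      intro _ C hC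
      have hI : Fig3.Inv_s13 C₀ := (Fig3.Inv_s13.init n).run hC₀
      rw [Fig3.cfgAt_succ hbegin, hC₀] at hC
      obtain ⟨h1, h2, h3⟩ := hI
      have hI2 := h2 a hitem
      simp only [Option.bind_some, Fig3.step] at hC
      split at hC <;> try contradiction
      split at hC <;> try contradiction
      cases hC
      constructor <;> (try dsimp only) <;> grind [Function.update_apply]
    | succ u hu ih =>
      intro hle C hC
      obtain ⟨E, hE⟩ := Option.isSome_iff_exists.1
        (Fig3.cfgAt_isSome_of_succ (hC ▸ rfl : (Fig3.cfgAt n tr (u + 1)).isSome))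
      have hP := ih (by omega) E hE
      have hlen : tEnd < tr.length := (List.getElem?_eq_some_iff.1 hend).1
      have he : tr[u]? = some tr[u] := List.getElem?_eq_getElem (by omega)
      rw [Fig3.cfgAt_succ he, hE] at hC
      refine hP.step hC ?_
      rintro ⟨j, y, hj, hy⟩
      exact hcon ⟨u, j, y, E, by omega, by omega, hE, by rw [he, hj], hy⟩
  obtain ⟨E, hE⟩ := Option.isSome_iff_exists.1 (Fig3.cfgAt_isSome_of_succ hvalid)
  have hP := key tEnd hlt le_rfl E hE
  rw [Fig3.cfgAt_succ hend, hE] at hvalid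
  rcases hP.cst with h | h | ⟨x, h⟩ <;> simp [Fig3.step, h] at hvalid
end

section
/- In every execution of the Figure 5 algorithm, after a Take operation performs a successful t&s() on TS[a], the producer must read the value 1 from TS[a] (in its check of TS[m] at the start of its loop body) before it next performs a reset() of TS[a]. -/
/-!
A formal model of the algorithm of Figure 5 (a lock-free,
strongly-linearizable `b`-bounded bag with one producer and `n` consumers).

Locations `1 .. n+b` are modelled as `Fin (n+b)`.  Registers holding elements
or ⊥ are modelled as `Option ℕ` (`none` = ⊥) and test&set objects as `Bool`
(`true` = 1).  The ABA-detecting registers `InsertDone` and `TakeDone` are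
modelled by write counters (`icount`, `tcount`) together with the counter
value recorded at the last `dRead()` of each reader (`ilast i` for consumer
`i` reading `InsertDone`; `tlast` for the producer reading `TakeDone`); a
`dRead()` returns `true` iff the reader has read before and the counter has
increased since.

An execution is a list of actions (`Act`), each performing (at most) one
shared-memory access; results of accesses and nondeterministic choices are
recorded in the action.  `step` is the (partial) transition function.  The
purely local control transitions at the end of the producer's scan of `alloc`
(`insScanDone`) are modelled as separate actions.
-/

namespace Fig5

/-- Local state of the producer, besides the persistent local variables
`used` and `alloc` kept in the configuration. -/
inductive PSt (n b : ℕ) where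
  | idle : PSt n b
  /-- scanning the locations of `alloc` that are still `pending` -/
  | scan (x : ℕ) (pending : Finset (Fin (n + b))) : PSt n b
  /-- collecting `Hazards`; `i` is the next index to read -/
  | collect (x : ℕ) (i : ℕ) (hz : Finset (Fin (n + b))) : PSt n b
  /-- about to choose a fresh location and write `Allocated` -/
  | allocSt (x : ℕ) (hz : Finset (Fin (n + b))) : PSt n b
  /-- chose location `m`; resetting the test&set objects in `todo` -/
  | resets (x : ℕ) (hz : Finset (Fin (n + b))) (m : Fin (n + b))
      (todo : Finset (Fin (n + b))) : PSt n b
  /-- wrote the element, about to perform `InsertDone.dWrite()` -/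
  | dw : PSt n b
  /-- `|alloc| = b`; about to re-read `TakeDone` -/
  | recheck (x : ℕ) : PSt n b
  deriving DecidableEq

/-- Local state of a consumer. -/
inductive CSt (n b : ℕ) where
  | idle : CSt n b
  /-- about to read `Allocated` -/
  | loopStart : CSt n b
  /-- iterating over the locations read from `Allocated` that are still
      `pending` -/
  | scan (pending : Finset (Fin (n + b))) : CSt n b
  /-- about to write `a` to `Hazards[i]` -/
  | haz (pending : Finset (Fin (n + b))) (a : Fin (n + b)) : CSt n b
  /-- about to read `Items[a]` -/
  | read (pending : Finset (Fin (n + b))) (a : Fin (n + b)) : CSt n b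
  /-- read `x ≠ ⊥` from `Items[a]`, about to perform `t&s()` on `TS[a]` -/
  | tas (pending : Finset (Fin (n + b))) (a : Fin (n + b)) (x : ℕ) : CSt n b
  /-- successful `t&s`; about to write ⊥ to `Hazards[i]` -/
  | retClear (x : ℕ) : CSt n b
  /-- about to perform `TakeDone.dWrite()` and return `x` -/
  | retDone (x : ℕ) : CSt n b
  /-- about to re-read `InsertDone` -/
  | recheck : CSt n b
  /-- about to perform `TakeDone.dWrite()` and return EMPTY -/
  | emptyDone : CSt n b
  deriving DecidableEq

structure Cfg (n b : ℕ) where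
  items : Fin (n + b) → Option ℕ
  ts : Fin (n + b) → Bool
  /-- the shared register `Allocated` -/
  allocated : Finset (Fin (n + b))
  haz : Fin n → Option (Fin (n + b))
  /-- number of `dWrite()`s to `InsertDone` -/
  icount : ℕ
  /-- value of `icount` at consumer `i`'s last `dRead()` of `InsertDone` -/
  ilast : Fin n → Option ℕ
  /-- number of `dWrite()`s to `TakeDone` -/
  tcount : ℕ
  /-- value of `tcount` at the producer's last `dRead()` of `TakeDone` -/
  tlast : Option ℕ
  pst : PSt n b
  /-- the producer's persistent local variable `used` -/
  used : Finset (Fin (n + b))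
  /-- the producer's persistent local variable `alloc` -/
  palloc : Finset (Fin (n + b))
  cst : Fin n → CSt n b

inductive Act (n b : ℕ) where
  /-- the producer begins `Insert(x)` by performing `TakeDone.dRead()` -/
  | insBegin (x : ℕ) : Act n b
  /-- the producer reads `TS[m]` for the pending location `m` of its scan,
      obtaining `v`; if `v = true` it also writes ⊥ to `Items[m]`, removes `m`
      from `alloc` and adds it to `used` -/
  | insScan (m : Fin (n + b)) (v : Bool) : Act n b
  /-- local step: the scan is finished; proceed according to `|alloc| < b` -/
  | insScanDone : Act n b
  /-- the producer reads the next entry of `Hazards` -/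
  | insCollect : Act n b
  /-- the producer chooses a fresh location `m'` (not in `alloc` and not
      hazardous), adds it to `alloc` and writes `alloc` to `Allocated` -/
  | insAlloc (m' : Fin (n + b)) : Act n b
  /-- the producer resets `TS[k]` -/
  | insReset (k : Fin (n + b)) : Act n b
  /-- the producer writes its element to `Items[m]` -/
  | insWrite : Act n b
  /-- the producer performs `InsertDone.dWrite()` and returns OK -/
  | insDone : Act n b
  /-- the producer re-reads `TakeDone`, obtaining `v`; if `v = false` the
      `Insert` completes returning FULL -/
  | insRecheck (v : Bool) : Act n b
  /-- consumer `i` begins `Take()` by performing `InsertDone.dRead()` -/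
  | takeBegin (i : Fin n) : Act n b
  /-- consumer `i` reads `Allocated` -/
  | takeAlloc (i : Fin n) : Act n b
  /-- consumer `i` picks the pending location `a` and writes it to
      `Hazards[i]` -/
  | takeHaz (i : Fin n) (a : Fin (n + b)) : Act n b
  /-- consumer `i` reads `Items[a]`, obtaining `xo` -/
  | takeRead (i : Fin n) (xo : Option ℕ) : Act n b
  /-- consumer `i` performs `t&s()` on `TS[a]`; `won = true` iff successful -/
  | takeTas (i : Fin n) (won : Bool) : Act n b
  /-- consumer `i` finished its scan; it writes ⊥ to `Hazards[i]` -/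
  | takeScanEnd (i : Fin n) : Act n b
  /-- consumer `i` writes ⊥ to `Hazards[i]` after a successful `t&s` -/
  | takeRetClear (i : Fin n) : Act n b
  /-- consumer `i` performs `TakeDone.dWrite()` and returns `x` -/
  | takeRetDone (i : Fin n) (x : ℕ) : Act n b
  /-- consumer `i` re-reads `InsertDone`, obtaining `v` -/
  | takeRecheck (i : Fin n) (v : Bool) : Act n b
  /-- consumer `i` performs `TakeDone.dWrite()` and returns EMPTY -/
  | takeEmptyDone (i : Fin n) : Act n b
  deriving DecidableEq

/-- Result of an `InsertDone.dRead()` by consumer `i`. -/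
def ireadVal {n b : ℕ} (C : Cfg n b) (i : Fin n) : Bool :=
  match C.ilast i with
  | none => false
  | some c => decide (c < C.icount)

/-- Result of a `TakeDone.dRead()` by the producer. -/
def treadVal {n b : ℕ} (C : Cfg n b) : Bool :=
  match C.tlast with
  | none => false
  | some c => decide (c < C.tcount)

def step (n b : ℕ) (C : Cfg n b) : Act n b → Option (Cfg n b)
  | .insBegin x =>
      match C.pst with
      | .idle =>
          some { C with
                   tlast := some C.tcount
                   pst := .scan x C.palloc }
      | _ => none
  | .insScan m v =>
      match C.pst with
      | .scan x pending =>
          if m ∈ pending ∧ v = C.ts m then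
            if v then
              some { C with
                       items := Function.update C.items m none
                       palloc := C.palloc.erase m
                       used := insert m C.used
                       pst := .scan x (pending.erase m) }
            else
              some { C with pst := .scan x (pending.erase m) }
          else none
      | _ => none
  | .insScanDone =>
      match C.pst with
      | .scan x pending =>
          if pending = ∅ then
            if C.palloc.card < b then
              some { C with pst := if n = 0 then .allocSt x ∅ else .collect x 0 ∅ }
            else
              some { C with pst := .recheck x }
          else none
      | _ => none
  | .insCollect =>
      match C.pst with
      | .collect x i hz =>
          if h : i < n then
            let hz' := match C.haz ⟨i, h⟩ with
                       | some a => insert a hz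
                       | none => hz
            some { C with pst := if i + 1 = n then .allocSt x hz' else .collect x (i + 1) hz' }
          else none
      | _ => none
  | .insAlloc m' =>
      match C.pst with
      | .allocSt x hz =>
          if m' ∈ C.palloc ∨ m' ∈ hz then none
          else
            some { C with
                     palloc := insert m' C.palloc
                     allocated := insert m' C.palloc
                     pst := .resets x hz m' (C.used \ hz) }
      | _ => none
  | .insReset k =>
      match C.pst with
      | .resets x hz m todo =>
          if k ∈ todo then
            some { C with
                     ts := Function.update C.ts k false
                     pst := .resets x hz m (todo.erase k) }
          else none
      | _ => none
  | .insWrite =>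
      match C.pst with
      | .resets x hz m todo =>
          if todo = ∅ then
            some { C with
                     items := Function.update C.items m (some x)
                     used := C.used ∩ hz
                     pst := .dw }
          else none
      | _ => none
  | .insDone =>
      match C.pst with
      | .dw => some { C with icount := C.icount + 1, pst := .idle }
      | _ => none
  | .insRecheck v =>
      match C.pst with
      | .recheck x =>
          if v = treadVal C then
            some { C with
                     tlast := some C.tcount
                     pst := if v then .scan x C.palloc else .idle }
          else none
      | _ => none
  | .takeBegin i =>
      match C.cst i with
      | .idle =>
          some { C with
                   ilast := Function.update C.ilast i (some C.icount)
                   cst := Function.update C.cst i .loopStart }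
      | _ => none
  | .takeAlloc i =>
      match C.cst i with
      | .loopStart =>
          some { C with cst := Function.update C.cst i (.scan C.allocated) }
      | _ => none
  | .takeHaz i a =>
      match C.cst i with
      | .scan pending =>
          if a ∈ pending then
            some { C with
                     haz := Function.update C.haz i (some a)
                     cst := Function.update C.cst i (.read (pending.erase a) a) }
          else none
      | _ => none
  | .takeRead i xo =>
      match C.cst i with
      | .read pending a =>
          if xo = C.items a then
            some { C with
                     cst := Function.update C.cst i
                       (match xo with
                        | some v => .tas pending a v
                        | none => .scan pending) }
          else none
      | _ => none
  | .takeTas i won =>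
      match C.cst i with
      | .tas pending a x =>
          if won = !(C.ts a) then
            some { C with
                     ts := Function.update C.ts a true
                     cst := Function.update C.cst i
                       (if won then .retClear x else .scan pending) }
          else none
      | _ => none
  | .takeScanEnd i =>
      match C.cst i with
      | .scan pending =>
          if pending = ∅ then
            some { C with
                     haz := Function.update C.haz i none
                     cst := Function.update C.cst i .recheck }
          else none
      | _ => none
  | .takeRetClear i =>
      match C.cst i with
      | .retClear x =>
          some { C with
                   haz := Function.update C.haz i none
                   cst := Function.update C.cst i (.retDone x) }
      | _ => none
  | .takeRetDone i x =>
      match C.cst i with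
      | .retDone x' =>
          if x = x' then
            some { C with
                     tcount := C.tcount + 1
                     cst := Function.update C.cst i .idle }
          else none
      | _ => none
  | .takeRecheck i v =>
      match C.cst i with
      | .recheck =>
          if v = ireadVal C i then
            some { C with
                     ilast := Function.update C.ilast i (some C.icount)
                     cst := Function.update C.cst i (if v then .loopStart else .emptyDone) }
          else none
      | _ => none
  | .takeEmptyDone i =>
      match C.cst i with
      | .emptyDone =>
          some { C with
                   tcount := C.tcount + 1
                   cst := Function.update C.cst i .idle }
      | _ => none

def init (n b : ℕ) : Cfg n b where
  items := fun _ => none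
  ts := fun _ => false
  allocated := ∅
  haz := fun _ => none
  icount := 0
  ilast := fun _ => none
  tcount := 0
  tlast := none
  pst := .idle
  used := ∅
  palloc := ∅
  cst := fun _ => .idle

def run (n b : ℕ) : List (Act n b) → Cfg n b → Option (Cfg n b)
  | [], C => some C
  | e :: tr, C => (step n b C e).bind (run n b tr)

/-- The configuration reached after the first `t` actions of `tr`. -/
def cfgAt (n b : ℕ) (tr : List (Act n b)) (t : ℕ) : Option (Cfg n b) :=
  run n b (tr.take t) (init n b)

end Fig5

namespace Fig5

/-- The effective set of used locations that have not been reset yet. -/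
def effUsed {n b : ℕ} (C : Cfg n b) : Finset (Fin (n + b)) :=
  match C.pst with
  | .resets _ hz _ todo => todo ∪ (C.used ∩ hz)
  | _ => C.used

/-- Every effectively used location has test&set value 1, and locations still to be
reset are not hazardous. -/
def Inv {n b : ℕ} (C : Cfg n b) : Prop :=
  (∀ a ∈ effUsed C, C.ts a = true) ∧
    ∀ x hz m todo, C.pst = .resets x hz m todo → ∀ k ∈ todo, k ∉ hz

theorem inv_init (n b : ℕ) : Inv (init n b) := by
  simp [Inv, effUsed, init]

theorem inv_step {n b : ℕ} {C C' : Cfg n b} {e : Act n b} (h : step n b C e = some C')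
    (hI : Inv C) : Inv C' := by
  obtain ⟨h1, h2⟩ := hI
  cases e <;> simp only [step] at h <;> split at h <;>
    (try split at h) <;> (try split at h) <;> (try (simp at h; done)) <;>
    simp only [Option.some.injEq] at h <;> subst h <;>
    simp_all [Inv, effUsed, Function.update_apply] <;> grind

theorem effUsed_step {n b : ℕ} {C C' : Cfg n b} {e : Act n b} {a : Fin (n + b)}
    (h : step n b C e = some C') (he : e ≠ .insScan a true) (ha : a ∉ effUsed C) :
    a ∉ effUsed C' := by
  cases e <;> simp only [step] at h <;> split at h <;>
    (try split at h) <;> (try split at h) <;> (try (simp at h; done)) <;>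
    simp only [Option.some.injEq] at h <;> subst h <;>
    simp_all [effUsed] <;> grind

theorem run_append (n b : ℕ) (l₁ l₂ : List (Act n b)) (C : Cfg n b) :
    run n b (l₁ ++ l₂) C = (run n b l₁ C).bind (run n b l₂) := by
  induction l₁ generalizing C with
  | nil => simp [run]
  | cons e l ih =>
    simp only [List.cons_append, run]
    cases step n b C e <;> simp [ih]

theorem cfgAt_succ {n b : ℕ} {tr : List (Act n b)} {t : ℕ} {e : Act n b}
    (he : tr[t]? = some e) :
    cfgAt n b tr (t + 1) = (cfgAt n b tr t).bind (fun C => step n b C e) := by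
  unfold cfgAt
  rw [List.take_add_one, he, run_append]
  congr 1
  funext C
  simp only [Option.toList, run]
  cases step n b C e <;> simp

theorem cfgAt_succ_cases {n b : ℕ} {tr : List (Act n b)} {t : ℕ} {C' : Cfg n b}
    (h : cfgAt n b tr (t + 1) = some C') :
    ∃ C, cfgAt n b tr t = some C ∧
      (C' = C ∧ tr[t]? = none ∨ ∃ e, tr[t]? = some e ∧ step n b C e = some C') := by
  cases he : tr[t]? with
  | none =>
    refine ⟨C', ?_, Or.inl ⟨rfl, rfl⟩⟩
    rw [← h]
    simp [cfgAt, List.take_add_one, he]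
  | some e =>
    rw [cfgAt_succ he] at h
    obtain ⟨C, hC, hs⟩ := Option.bind_eq_some_iff.mp h
    exact ⟨C, hC, Or.inr ⟨e, rfl, hs⟩⟩

theorem inv_cfgAt {n b : ℕ} {tr : List (Act n b)} :
    ∀ (t : ℕ) (C : Cfg n b), cfgAt n b tr t = some C → Inv C := by
  intro t
  induction t with
  | zero =>
    intro C h
    simp only [cfgAt, List.take_zero, run, Option.some.injEq] at h
    exact h ▸ inv_init n b
  | succ t ih =>
    intro C' h
    obtain ⟨C, hC, ⟨rfl, _⟩ | ⟨e, _, hs⟩⟩ := cfgAt_succ_cases h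
    · exact ih _ hC
    · exact inv_step hs (ih _ hC)

end Fig5

/--
In every execution of the Figure 5 algorithm, after a `Take`
operation performs a successful `t&s()` on `TS[a]` (at position `t`), the
producer must read the value 1 from `TS[a]` (in its check of `TS[m]` at the
start of its loop body, i.e. an `insScan a true` action) before it next
performs a `reset()` of `TS[a]` (at position `r`, the first reset of `TS[a]`
after `t`).
-/
theorem fig5_producer_reads_one_before_reset (n b : ℕ) (tr : List (Fig5.Act n b))
    (t r : ℕ) (i : Fin n) (a : Fin (n + b)) (p : Finset (Fin (n + b))) (x : ℕ)
    (Ct : Fig5.Cfg n b)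
    (hCt : Fig5.cfgAt n b tr t = some Ct)
    (htas : tr[t]? = some (Fig5.Act.takeTas i true))
    (hst : Ct.cst i = Fig5.CSt.tas p a x)
    (hvalid : (Fig5.cfgAt n b tr (t + 1)).isSome)
    (htr : t < r)
    (hreset : tr[r]? = some (Fig5.Act.insReset a))
    (hvalidr : (Fig5.cfgAt n b tr (r + 1)).isSome)
    -- `r` is the first reset of `TS[a]` after `t`
    (hfirst : ∀ v, t < v → v < r → tr[v]? ≠ some (Fig5.Act.insReset a)) :
    ∃ u, t < u ∧ u < r ∧ tr[u]? = some (Fig5.Act.insScan a true) := by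
  by_contra hno
  push Not at hno
  have key : ∀ d C, t + d ≤ r → Fig5.cfgAt n b tr (t + d) = some C → a ∉ Fig5.effUsed C := by
    intro d
    induction d with
    | zero =>
      intro C _ hC ha
      have hCC : Ct = C := by
        rw [Nat.add_zero, hCt] at hC
        exact Option.some.inj hC
      subst hCC
      have h1 := (Fig5.inv_cfgAt t Ct hCt).1 a ha
      rw [Fig5.cfgAt_succ htas, hCt] at hvalid
      simp [Fig5.step, hst, h1] at hvalid
    | succ d ih =>
      intro C' hle h
      obtain ⟨C, hC, ⟨rfl, _⟩ | ⟨e, he, hs⟩⟩ := Fig5.cfgAt_succ_cases h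
      · exact ih _ (by omega) hC
      · refine Fig5.effUsed_step hs ?_ (ih _ (by omega) hC)
        rintro rfl
        rcases Nat.eq_zero_or_pos d with rfl | hd
        · change tr[t]? = _ at he
          rw [htas] at he
          simp at he
        · exact hno (t + d) (by omega) (by omega) he
  obtain ⟨C', hC'⟩ := Option.isSome_iff_exists.mp hvalidr
  obtain ⟨C, hC, ⟨_, hn⟩ | ⟨e, he, hs⟩⟩ := Fig5.cfgAt_succ_cases hC'
  · rw [hreset] at hn
    simp at hn
  · have hk := key (r - t) C (by omega) (by rw [show t + (r - t) = r by omega]; exact hC)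
    rw [hreset] at he
    obtain rfl := Option.some.inj he
    simp only [Fig5.step] at hs
    split at hs
    · rename_i x' hz m todo hp
      split at hs
      · rename_i hmem
        exact hk (by simp [Fig5.effUsed, hp, hmem])
      · simp at hs
    · simp at hs
end
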